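/- arXiv:1502.04248 — 3 statements merged into one kernel-verified Lean document; each statement's English description precedes it below -/
import Mathlib

section
/- Let p be a bounded continuous probability density on ℝ^d and let ∂S be a hypersurface (the boundary of a measurable set S) whose (d−1)-dimensional Hausdorff measure μ satisfies 0 < μ(∂S) < ∞; assume ∫_S p(x) dx > 0 and sup_{s ∈ ∂S} p(s) > 0. Let t(m) = Σ_{r=1}^{m−1} binom(m−1, r) (−1)^r (√(r+1) − √r). Then lim_{m → ∞} ( (|t(m)|/√(2π)) · ∫_{∂S} p(s)^{m+1} dμ(s) / ∫_S p(x) dx )^{1/m} = sup_{s ∈ ∂S} p(s), where the supremum is the essential supremum of p on ∂S with respect to μ. -/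
open MeasureTheory ProbabilityTheory Filter Real Matrix Finset
open scoped Topology ENNReal NNReal BigOperators RealInnerProductSpace

noncomputable section

/-- Gaussian kernel with variance parameter `t` on `ℝ^d`. -/
def gaussKernel (d : ℕ) (t : ℝ) (x y : EuclideanSpace ℝ (Fin d)) : ℝ :=
  (2 * Real.pi * t) ^ (-(d : ℝ) / 2) * Real.exp (-‖x - y‖ ^ 2 / (2 * t))

/-- Adjacency matrix of the similarity graph with Gaussian weights of parameter `σ`
(no self-loops). -/
def adjacencyMatrix {d n : ℕ} (σ : ℝ) (X : Fin n → EuclideanSpace ℝ (Fin d)) :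
    Matrix (Fin n) (Fin n) ℝ :=
  fun i j => if i = j then 0 else gaussKernel d (σ ^ 2) (X i) (X j)

/-- Degree matrix of the similarity graph. -/
def degreeMatrix {d n : ℕ} (σ : ℝ) (X : Fin n → EuclideanSpace ℝ (Fin d)) :
    Matrix (Fin n) (Fin n) ℝ :=
  Matrix.diagonal fun i => ∑ j, adjacencyMatrix σ X i j

/-- Graph Laplacian `L = (1/n)(D − W)`. -/
def graphLaplacian {d n : ℕ} (σ : ℝ) (X : Fin n → EuclideanSpace ℝ (Fin d)) :
    Matrix (Fin n) (Fin n) ℝ :=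
  (n : ℝ)⁻¹ • (degreeMatrix σ X - adjacencyMatrix σ X)

/-- Indicator vector of the sample points falling in the set `S`. -/
def indicatorVec {d n : ℕ} (S : Set (EuclideanSpace ℝ (Fin d)))
    (X : Fin n → EuclideanSpace ℝ (Fin d)) : Fin n → ℝ :=
  fun i => S.indicator (fun _ => (1 : ℝ)) (X i)

/-- The coefficient `t(m) = Σ_{r=1}^{m−1} binom(m−1, r) (−1)^r (√(r+1) − √r)`. -/
def tCoeff (m : ℕ) : ℝ :=
  ∑ r ∈ Finset.Ico 1 m, ((m - 1).choose r : ℝ) * (-1) ^ r *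
    (Real.sqrt (r + 1) - Real.sqrt r)

/-- The alternating differences of `a ↦ (t + a)⁻¹` have a product formula. -/
lemma neg_one_pow_mul_fwdDiff_iter_inv {t : ℝ} (ht : 0 < t) (k a : ℕ) :
    (-1) ^ k * ((fwdDiff 1)^[k] fun b : ℕ => (t + b)⁻¹) a =
      k.factorial / ∏ j ∈ Finset.range (k + 1), (t + a + j) := by
  induction k generalizing a with
  | zero => simp
  | succ k ih =>
    have h1 := ih a
    have h2 := ih (a + 1)
    rw [Function.iterate_succ_apply', fwdDiff, pow_succ]
    have key : (-1 : ℝ) ^ k * -1 * (((fwdDiff 1)^[k] fun b : ℕ => (t + b)⁻¹) (a + 1) -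
        ((fwdDiff 1)^[k] fun b : ℕ => (t + b)⁻¹) a) =
        k.factorial / ∏ j ∈ Finset.range (k + 1), (t + a + j) -
        k.factorial / ∏ j ∈ Finset.range (k + 1), (t + (a + 1 : ℕ) + j) := by
      rw [← h1, ← h2]; ring
    rw [key]
    have e1 : ∏ j ∈ Finset.range (k + 2), (t + a + j) =
        (∏ j ∈ Finset.range (k + 1), (t + a + j)) * (t + a + (k + 1)) := by
      rw [Finset.prod_range_succ]; push_cast; ring
    have e2 : ∏ j ∈ Finset.range (k + 2), (t + a + j) =
        (∏ j ∈ Finset.range (k + 1), (t + (a + 1 : ℕ) + j)) * (t + a) := by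
      rw [Finset.prod_range_succ']
      push_cast
      rw [add_zero]
      congr 1
      exact Finset.prod_congr rfl fun j _ => by ring
    have p1 : 0 < ∏ j ∈ Finset.range (k + 1), (t + a + j) :=
      Finset.prod_pos fun j _ => by positivity
    have p2 : 0 < ∏ j ∈ Finset.range (k + 1), (t + (a + 1 : ℕ) + j) :=
      Finset.prod_pos fun j _ => by positivity
    rw [Nat.factorial_succ]
    push_cast at *
    rw [e1]
    rw [e1] at e2
    generalize (∏ j ∈ Finset.range (k + 1), (t + (a : ℝ) + j)) = P at *
    generalize (∏ j ∈ Finset.range (k + 1), (t + ((a : ℝ) + 1) + j)) = Q at *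
    have h3 : 0 < t + a := by positivity
    have h4 : 0 < t + a + (k + 1) := by positivity
    rw [div_sub_div _ _ p1.ne' p2.ne', div_eq_div_iff (by positivity) (by positivity)]
    linear_combination (-(k.factorial : ℝ) * P) * e2

/-- Forward differences of natural number sequences commute with integrals over a parameter. -/
lemma fwdDiff_iter_integral {α : Type*} [MeasurableSpace α] {μ : Measure α}
    {F : ℕ → α → ℝ} (hF : ∀ a, Integrable (F a) μ) (k a : ℕ) :
    Integrable (fun t => ((fwdDiff 1)^[k] fun b => F b t) a) μ ∧
      ((fwdDiff 1)^[k] fun b => ∫ t, F b t ∂μ) a = ∫ t, ((fwdDiff 1)^[k] fun b => F b t) a ∂μ := by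
  induction k generalizing a with
  | zero => simpa using hF a
  | succ k ih =>
    simp only [Function.iterate_succ_apply', fwdDiff]
    exact ⟨(ih (a + 1)).1.sub (ih a).1, by
      rw [(ih (a + 1)).2, (ih a).2, integral_sub (ih (a + 1)).1 (ih a).1]⟩

/-- The forward differences of positive order of the square root alternate in sign. -/
lemma neg_one_pow_mul_fwdDiff_iter_sqrt_nonneg (k a : ℕ) :
    0 ≤ (-1) ^ k * ((fwdDiff 1)^[k + 1] fun b : ℕ => √(b : ℝ)) a := by
  have hh : (1 / 2 : ℝ) ∈ Set.Ioo (0 : ℝ) 1 := by norm_num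
  obtain ⟨ν, hν⟩ := Real.exists_measure_rpow_eq_integral_rpowIntegrand₀₁ hh
  have hsqrt : (fun b : ℕ => √(b : ℝ)) =
      fun b : ℕ => ∫ t in Set.Ioi 0, Real.rpowIntegrand₀₁ (1 / 2) t b ∂ν := by
    funext b
    rw [Real.sqrt_eq_rpow, (hν b (Set.mem_Ici.2 b.cast_nonneg)).2]
  rw [hsqrt, (fwdDiff_iter_integral (fun b => (hν b (Set.mem_Ici.2 b.cast_nonneg)).1) _ _).2,
    ← integral_const_mul]
  refine setIntegral_nonneg measurableSet_Ioi fun t ht => ?_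
  have ht' : 0 < t := ht
  have e : (fwdDiff 1 fun b : ℕ => Real.rpowIntegrand₀₁ (1 / 2) t b) =
      (-(t ^ (1 / 2 : ℝ))) • fwdDiff 1 fun b : ℕ => (t + b)⁻¹ := by
    funext b
    simp only [fwdDiff, Real.rpowIntegrand₀₁, Pi.smul_apply, smul_eq_mul]
    ring
  rw [Function.iterate_succ_apply, e, fwdDiff_iter_const_smul, ← Function.iterate_succ_apply,
    Pi.smul_apply, smul_eq_mul]
  have := neg_one_pow_mul_fwdDiff_iter_inv ht' (k + 1) a
  have hpos : 0 ≤ (-1) ^ (k + 1) * ((fwdDiff 1)^[k + 1] fun b : ℕ => (t + b)⁻¹) a := by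
    rw [this]
    exact div_nonneg (by positivity) (Finset.prod_nonneg fun j _ => by positivity)
  calc (0 : ℝ) ≤ t ^ (1 / 2 : ℝ) *
        ((-1) ^ (k + 1) * ((fwdDiff 1)^[k + 1] fun b : ℕ => (t + b)⁻¹) a) := by positivity
    _ = _ := by ring

/-- `tCoeff` is a forward difference of the square root, up to sign and the missing term `r = 0`. -/
lemma tCoeff_succ_add_one (n : ℕ) :
    tCoeff (n + 1) + 1 = (-1) ^ n * ((fwdDiff 1)^[n + 1] fun b : ℕ => √(b : ℝ)) 0 := by
  rw [Function.iterate_succ_apply, fwdDiff_iter_eq_sum_shift, Finset.mul_sum,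
    Finset.range_eq_Ico, Finset.sum_eq_sum_Ico_succ_bot (by omega), tCoeff, add_comm]
  congr 1
  · simp [fwdDiff, ← mul_pow]
  · refine Finset.sum_congr rfl fun r hr => ?_
    obtain ⟨j, hj⟩ := Nat.exists_eq_add_of_le (Nat.le_of_lt_succ (Finset.mem_Ico.1 hr).2)
    have : n - r = j := by omega
    simp only [fwdDiff, this, zsmul_eq_mul]
    subst hj
    have h1 : (-1 : ℝ) ^ j * (-1) ^ j = 1 := by simp [← mul_pow]
    push_cast
    simp only [smul_eq_mul, mul_one, zero_add, pow_add]
    linear_combination (-((r + j).choose r : ℝ) * (-1) ^ r * (√(r + 1) - √r)) * h1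

/-- The coefficients `tCoeff m` are bounded, negative and stay away from `0`. -/
lemma tCoeff_mem_Icc {m : ℕ} (hm : 2 ≤ m) : tCoeff m ∈ Set.Icc (-1) (1 - √2) := by
  obtain ⟨n, rfl⟩ : ∃ n, m = n + 1 := ⟨m - 1, by omega⟩
  constructor
  · linarith [tCoeff_succ_add_one n, neg_one_pow_mul_fwdDiff_iter_sqrt_nonneg n 0]
  · induction n, (by omega : 1 ≤ n) using Nat.le_induction with
    | base =>
      rw [tCoeff, Finset.sum_Ico_eq_sum_range]
      simp [one_add_one_eq_two]
    | succ n hn ih =>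
      refine le_trans ?_ (ih (by omega))
      have h := neg_one_pow_mul_fwdDiff_iter_sqrt_nonneg n 1
      have h1 := tCoeff_succ_add_one n
      have h2 := tCoeff_succ_add_one (n + 1)
      rw [Function.iterate_succ_apply', fwdDiff, zero_add, pow_succ] at h2
      linarith

/-- The exponential growth rate of the moments of a bounded nonnegative function with respect to a
nonzero finite measure is its essential supremum, also after multiplying the moments by constants
that eventually lie between two positive numbers. -/
lemma tendsto_const_mul_integral_pow_rpow_inv {α : Type*} [MeasurableSpace α] {μ : Measure α}
    [IsFiniteMeasure μ] [NeZero μ] {p : α → ℝ} (hp_meas : Measurable p) (hp_nonneg : ∀ x, 0 ≤ p x)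
    (hp_bdd : ∃ M : ℝ, ∀ x, p x ≤ M) (hsup : 0 < essSup p μ)
    {K : ℕ → ℝ} {k₁ k₂ : ℝ} (hk₁ : 0 < k₁) (hK : ∀ᶠ m in atTop, K m ∈ Set.Icc k₁ k₂) :
    Tendsto (fun m : ℕ => (K m * ∫ x, p x ^ (m + 1) ∂μ) ^ ((m : ℝ)⁻¹)) atTop
      (𝓝 (essSup p μ)) := by
  obtain ⟨M, hM⟩ := hp_bdd
  have hk₂ : 0 < k₂ := by
    obtain ⟨m, hm⟩ := hK.exists
    exact hk₁.trans_le (hm.1.trans hm.2)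
  have hbdd : IsBoundedUnder (· ≤ ·) (ae μ) p := isBoundedUnder_of ⟨M, hM⟩
  have hcobdd : IsCoboundedUnder (· ≤ ·) (ae μ) p := isCoboundedUnder_le_of_le _ hp_nonneg
  have hint (n : ℕ) : Integrable (fun x => p x ^ n) μ :=
    Integrable.of_bound (hp_meas.pow_const n).aestronglyMeasurable (M ^ n) <| ae_of_all _ fun x => by
      rw [Real.norm_of_nonneg (pow_nonneg (hp_nonneg x) n)]
      exact pow_le_pow_left₀ (hp_nonneg x) (hM x) n
  have hroot {A c : ℝ} (hA : 0 < A) (hc : 0 < c) :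
      Tendsto (fun m : ℕ => (A * c ^ (m + 1)) ^ ((m : ℝ)⁻¹)) atTop (𝓝 c) := by
    have h1 : Tendsto (fun m : ℕ => (A * c) ^ ((m : ℝ)⁻¹) * c) atTop (𝓝 ((A * c) ^ (0 : ℝ) * c)) :=
      (tendsto_const_nhds.rpow (tendsto_inv_atTop_nhds_zero_nat (𝕜 := ℝ))
        (Or.inl (by positivity))).mul_const c
    rw [Real.rpow_zero, one_mul] at h1
    refine h1.congr' ?_
    filter_upwards [eventually_ne_atTop 0] with m hm
    rw [pow_succ', ← mul_assoc, Real.mul_rpow (x := A * c) (by positivity) (by positivity),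
      Real.pow_rpow_inv_natCast hc.le hm]
  have hI (m : ℕ) : 0 ≤ ∫ x, p x ^ (m + 1) ∂μ :=
    integral_nonneg fun x => pow_nonneg (hp_nonneg x) _
  refine tendsto_order.2 ⟨fun b hb => ?_, fun b hb => ?_⟩
  · obtain ⟨c, hbc, hc⟩ := exists_between (max_lt hb hsup)
    have hc0 : 0 < c := (le_max_right _ _).trans_lt hbc
    have hfreq : ∃ᶠ x in ae μ, c < p x := frequently_lt_of_lt_limsup hcobdd hc
    have hμ : 0 < μ.real {x | c < p x} :=
      ENNReal.toReal_pos (frequently_ae_iff.1 hfreq) (measure_ne_top _ _)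
    filter_upwards [(hroot (mul_pos hk₁ hμ) hc0).eventually
      (lt_mem_nhds ((le_max_left _ _).trans_lt hbc)), hK] with m hm hKm
    refine hm.trans_le (Real.rpow_le_rpow (by positivity) ?_ (by positivity))
    have hs : MeasurableSet {x | c < p x} := measurableSet_lt measurable_const hp_meas
    have : μ.real {x | c < p x} * c ^ (m + 1) ≤ ∫ x, p x ^ (m + 1) ∂μ := by
      calc μ.real {x | c < p x} * c ^ (m + 1)
          = ∫ _ in {x | c < p x}, c ^ (m + 1) ∂μ := by simp
        _ ≤ ∫ x in {x | c < p x}, p x ^ (m + 1) ∂μ :=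
            setIntegral_mono_on (integrable_const _) (hint _).integrableOn hs fun x hx =>
              pow_le_pow_left₀ hc0.le (le_of_lt hx) _
        _ ≤ ∫ x, p x ^ (m + 1) ∂μ :=
            setIntegral_le_integral (hint _) (ae_of_all _ fun x => pow_nonneg (hp_nonneg x) _)
    rw [mul_assoc]
    exact mul_le_mul hKm.1 this (by positivity) (hk₁.le.trans hKm.1)
  · have hμ : 0 < μ.real Set.univ :=
      ENNReal.toReal_pos (by simpa using NeZero.ne μ) (measure_ne_top _ _)
    filter_upwards [(hroot (mul_pos hk₂ hμ) hsup).eventually (gt_mem_nhds hb), hK] with m hm hKm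
    refine lt_of_le_of_lt (Real.rpow_le_rpow (mul_nonneg (hk₁.le.trans hKm.1) (hI m)) ?_
      (by positivity)) hm
    have : ∫ x, p x ^ (m + 1) ∂μ ≤ μ.real Set.univ * essSup p μ ^ (m + 1) := by
      calc ∫ x, p x ^ (m + 1) ∂μ ≤ ∫ _, essSup p μ ^ (m + 1) ∂μ := by
            refine integral_mono_ae (hint _) (integrable_const _) ?_
            filter_upwards [ae_le_essSup hbdd] with x hx
            exact pow_le_pow_left₀ (hp_nonneg x) hx _
        _ = _ := by simp
    rw [mul_assoc]
    exact mul_le_mul hKm.2 this (hI m) hk₂.le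

theorem limit_of_bias_ratio
    (d : ℕ) (hd : 0 < d)
    -- `p` is a bounded continuous probability density:
    (p : EuclideanSpace ℝ (Fin d) → ℝ)
    (hp_nonneg : ∀ x, 0 ≤ p x) (hp_cont : Continuous p)
    (hp_bdd : ∃ M : ℝ, ∀ x, p x ≤ M)
    (hp_prob : ∫ x, p x = 1)
    -- `∂S` is the boundary of a measurable set `S`, of positive finite
    -- `(d−1)`-dimensional Hausdorff measure:
    (S : Set (EuclideanSpace ℝ (Fin d))) (hSmeas : MeasurableSet S)
    (hfin : μH[(d : ℝ) - 1] (frontier S) < ⊤)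
    (hpos : 0 < μH[(d : ℝ) - 1] (frontier S))
    -- positivity assumptions:
    (hint : 0 < ∫ x in S, p x)
    (hsup : 0 < essSup p (μH[(d : ℝ) - 1].restrict (frontier S))) :
    Tendsto
      (fun m : ℕ =>
        (|tCoeff m| / Real.sqrt (2 * Real.pi) *
            (∫ s in frontier S, p s ^ (m + 1) ∂μH[(d : ℝ) - 1]) /
          ∫ x in S, p x) ^ ((m : ℝ)⁻¹))
      atTop (𝓝 (essSup p (μH[(d : ℝ) - 1].restrict (frontier S)))) := by
  have : IsFiniteMeasure (μH[(d : ℝ) - 1].restrict (frontier S)) :=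
    ⟨by rwa [Measure.restrict_apply_univ]⟩
  have : NeZero (μH[(d : ℝ) - 1].restrict (frontier S)) :=
    ⟨by rw [Ne, Measure.restrict_eq_zero]; exact hpos.ne'⟩
  have h2 : 0 < √2 - 1 := by
    rw [sub_pos, Real.lt_sqrt] <;> norm_num
  set J := ∫ x in S, p x
  have hK : ∀ᶠ m in atTop, |tCoeff m| / √(2 * π) / J ∈
      Set.Icc ((√2 - 1) / √(2 * π) / J) (1 / √(2 * π) / J) := by
    filter_upwards [eventually_ge_atTop 2] with m hm
    obtain ⟨hl, hu⟩ := tCoeff_mem_Icc hm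
    rw [abs_of_neg (by linarith)]
    constructor <;> gcongr <;> linarith
  refine (tendsto_const_mul_integral_pow_rpow_inv hp_cont.measurable hp_nonneg hp_bdd hsup
    (by positivity) hK).congr fun m => ?_
  rw [div_mul_eq_mul_div]
end
end

section
/- Define t(m) = Σ_{r=1}^{m−1} binom(m−1, r) (−1)^r (√(r+1) − √r) for integers m ≥ 2. Then lim_{m → ∞} |t(m)|^{1/m} = 1. -/
open Filter Real Finset
open scoped Topology BigOperators

noncomputable section

open scoped fwdDiff

theorem hasDerivAt_fwdDiff_iter {f f' : ℝ → ℝ} (h : ∀ x, 0 < x → HasDerivAt f (f' x) x) (n : ℕ) :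
    ∀ x, 0 < x → HasDerivAt (Δ_[(1 : ℝ)] ^[n] f) (Δ_[(1 : ℝ)] ^[n] f' x) x := by
  induction n generalizing f f' with
  | zero => exact h
  | succ n ih =>
    rw [Function.iterate_succ]
    refine ih fun x hx => ?_
    exact ((h (x + 1) (by linarith)).comp_add_const x 1).sub (h x hx)

theorem continuous_fwdDiff_iter {f : ℝ → ℝ} (h : Continuous f) (n : ℕ) :
    Continuous (Δ_[(1 : ℝ)] ^[n] f) := by
  induction n generalizing f with
  | zero => exact h
  | succ n ih =>
    rw [Function.iterate_succ]
    exact ih ((h.comp (continuous_add_const 1)).sub h)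

/-- Negative powers have iterated forward differences of alternating sign. -/
theorem neg_one_pow_mul_fwdDiff_iter_rpow_nonneg (n : ℕ) {s : ℝ} (hs : s < 0) {x : ℝ} (hx : 0 < x) :
    0 ≤ (-1) ^ n * Δ_[(1 : ℝ)] ^[n] (fun y : ℝ => y ^ s) x := by
  induction n generalizing s x with
  | zero => simpa using rpow_nonneg hx.le s
  | succ n ih =>
    have hd : ∀ y : ℝ, 0 < y → HasDerivAt (Δ_[(1 : ℝ)] ^[n] (fun y : ℝ => y ^ s))
        (s * Δ_[(1 : ℝ)] ^[n] (fun y : ℝ => y ^ (s - 1)) y) y := by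
      intro y hy
      have := hasDerivAt_fwdDiff_iter (f := fun y : ℝ => y ^ s)
        (f' := s • fun y : ℝ => y ^ (s - 1))
        (fun z hz => Real.hasDerivAt_rpow_const (Or.inl hz.ne')) n y hy
      rwa [fwdDiff_iter_const_smul] at this
    have hanti : AntitoneOn
        (fun y => (-1) ^ n * Δ_[(1 : ℝ)] ^[n] (fun y : ℝ => y ^ s) y) (Set.Ioi 0) := by
      refine antitoneOn_of_hasDerivWithinAt_nonpos (convex_Ioi 0)
        (fun y hy => ((hd y hy).const_mul _).continuousAt.continuousWithinAt)
        (fun y hy => ((hd y (interior_subset hy)).const_mul _).hasDerivWithinAt) fun y hy => ?_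
      have := ih (s := s - 1) (by linarith) (interior_subset hy : 0 < y)
      nlinarith
    have := hanti (Set.mem_Ioi.2 hx) (Set.mem_Ioi.2 (by linarith : 0 < x + 1)) (by linarith)
    rw [Function.iterate_succ_apply', fwdDiff, pow_succ]
    simp only at this
    linarith

theorem neg_one_pow_mul_fwdDiff_iter_succ_sqrt_nonneg (n : ℕ) {x : ℝ} (hx : 0 ≤ x) :
    0 ≤ (-1) ^ n * Δ_[(1 : ℝ)] ^[n + 1] (fun y : ℝ => √y) x := by
  have hd : ∀ y : ℝ, 0 < y → HasDerivAt (Δ_[(1 : ℝ)] ^[n] (fun y : ℝ => √y))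
      ((1 / 2) * Δ_[(1 : ℝ)] ^[n] (fun y : ℝ => y ^ (-(1 / 2) : ℝ)) y) y := by
    intro y hy
    have := hasDerivAt_fwdDiff_iter (f := fun y : ℝ => √y)
      (f' := (1 / 2 : ℝ) • fun y : ℝ => y ^ (-(1 / 2) : ℝ))
      (fun z hz => by
        convert Real.hasDerivAt_sqrt hz.ne' using 1
        simp only [Pi.smul_apply, smul_eq_mul]
        rw [rpow_neg hz.le, ← sqrt_eq_rpow]
        field_simp) n y hy
    rwa [fwdDiff_iter_const_smul] at this
  have hmono : MonotoneOn
      (fun y => (-1) ^ n * Δ_[(1 : ℝ)] ^[n] (fun y : ℝ => √y) y) (Set.Ici 0) := by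
    refine monotoneOn_of_hasDerivWithinAt_nonneg (convex_Ici 0)
      (continuous_const.mul (continuous_fwdDiff_iter continuous_sqrt n)).continuousOn
      (fun y hy => ((hd y (by simpa using hy)).const_mul _).hasDerivWithinAt) fun y hy => ?_
    have := neg_one_pow_mul_fwdDiff_iter_rpow_nonneg n (s := -(1 / 2)) (by norm_num)
      (by simpa using hy : 0 < y)
    linarith
  have := hmono (Set.mem_Ici.2 hx) (Set.mem_Ici.2 (by linarith : 0 ≤ x + 1)) (by linarith)
  rw [Function.iterate_succ_apply', fwdDiff]
  simp only at this
  linarith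

theorem tCoeff_succ_eq (n : ℕ) :
    tCoeff (n + 1) = (-1) ^ n * Δ_[(1 : ℝ)] ^[n + 1] (fun y : ℝ => √y) 0 - 1 := by
  rw [Function.iterate_succ_apply, fwdDiff_iter_eq_sum_shift, Finset.mul_sum,
    Finset.sum_range_eq_add_Ico _ n.succ_pos, tCoeff]
  have h (k : ℕ) (hk : k ≤ n) : (-1 : ℝ) ^ n * (-1) ^ (n - k) = (-1) ^ k := by
    obtain ⟨j, rfl⟩ := Nat.exists_eq_add_of_le hk
    rw [Nat.add_sub_cancel_left, pow_add, mul_assoc, ← mul_pow]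
    simp
  have h0 := h 0 n.zero_le
  simp only [Nat.sub_zero, pow_zero] at h0
  simp only [fwdDiff, zsmul_eq_mul, nsmul_eq_mul, Int.cast_mul, Int.cast_pow, Int.cast_neg,
    Int.cast_one, Int.cast_natCast, Nat.sub_zero, Nat.choose_zero_right, Nat.cast_one, mul_one,
    Nat.cast_zero, add_zero, zero_add, sqrt_one, sqrt_zero, sub_zero, h0, Nat.add_sub_cancel]
  rw [add_sub_cancel_left]
  refine Finset.sum_congr rfl fun k hk => ?_
  rw [← h k (by have := Finset.mem_Ico.1 hk; omega)]
  ring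

theorem tCoeff_antitone_succ : Antitone fun n : ℕ => tCoeff (n + 1) := by
  refine antitone_nat_of_succ_le fun n => ?_
  have h := neg_one_pow_mul_fwdDiff_iter_succ_sqrt_nonneg n (x := 0 + 1) (by norm_num)
  rw [tCoeff_succ_eq, tCoeff_succ_eq, Function.iterate_succ_apply' _ (n + 1), fwdDiff, pow_succ]
  linarith

theorem tCoeff_two : tCoeff 2 = 1 - √2 := by
  norm_num [tCoeff]

theorem tCoeff_root_limit :
    Tendsto (fun m : ℕ => |tCoeff m| ^ ((m : ℝ)⁻¹)) atTop (𝓝 1) := by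
  have hsqrt : 1 < √2 := by rw [lt_sqrt] <;> norm_num
  have hlow : Tendsto (fun m : ℕ => (√2 - 1) ^ ((m : ℝ)⁻¹)) atTop (𝓝 1) := by
    have := (continuousAt_const_rpow (b := 0) (sub_pos.2 hsqrt).ne').tendsto.comp
      (tendsto_inv_atTop_nhds_zero_nat (𝕜 := ℝ))
    simpa [Function.comp_def] using this
  refine tendsto_of_tendsto_of_tendsto_of_le_of_le' hlow tendsto_const_nhds ?_ ?_ <;>
    filter_upwards [eventually_ge_atTop 2] with m hm <;>
    obtain ⟨n, rfl⟩ := Nat.exists_eq_add_of_le' (one_le_two.trans hm) <;>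
    have hupper : tCoeff (n + 1) ≤ 1 - √2 :=
      tCoeff_two ▸ tCoeff_antitone_succ (by omega : 1 ≤ n)
  · exact rpow_le_rpow (by linarith) (by rw [abs_of_neg] <;> linarith) (by positivity)
  · have hnonneg := neg_one_pow_mul_fwdDiff_iter_succ_sqrt_nonneg n le_rfl
    have := tCoeff_succ_eq n
    exact rpow_le_one (abs_nonneg _) (by rw [abs_of_neg] <;> linarith) (by positivity)
end
end

section
/- Let L be a real symmetric positive semidefinite n×n matrix with orthonormal eigenvectors u_1,…,u_n and eigenvalues λ_1,…,λ_n ≥ 0, and let f ∈ ℝ^n be nonzero. Then the sequence of bandwidth estimates ω_m(f) = (f^T L^m f / f^T f)^{1/m} converges as m → ∞ to the bandwidth ω(f) = max{ λ_i : ⟨f, u_i⟩ ≠ 0 }, i.e., to the largest eigenvalue of L whose eigenspace has a nonzero component of f. -/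
open Matrix Filter
open scoped Topology BigOperators

noncomputable section

/-- The bandwidth of a signal `f ∈ ℝ^n` with respect to the eigendecomposition
`(λ, u)` of a symmetric matrix: the largest eigenvalue `λ i` such that the
coefficient `⟨f, u i⟩` is nonzero. -/
def signalBandwidth {n : ℕ} (lam : Fin n → ℝ) (u : Fin n → Fin n → ℝ)
    (f : Fin n → ℝ) : ℝ :=
  sSup (lam '' {i | u i ⬝ᵥ f ≠ 0})

/-- The power means of nonnegative numbers `a i`, with nonnegative weights `w i` of total mass one,
converge to the largest `a j` of positive weight. -/
theorem tendsto_weighted_powerMean_atTop {ι : Type*} [Fintype ι] (w a : ι → ℝ)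
    (hw : ∀ i, 0 ≤ w i) (hw1 : ∑ i, w i = 1) (ha : ∀ i, 0 ≤ a i) (j : ι) (hj : w j ≠ 0)
    (hmax : ∀ i, w i ≠ 0 → a i ≤ a j) :
    Tendsto (fun m : ℕ => (∑ i, w i * a i ^ m) ^ ((m : ℝ)⁻¹)) atTop (𝓝 (a j)) := by
  have hroot : Tendsto (fun m : ℕ => w j ^ ((m : ℝ)⁻¹) * a j) atTop (𝓝 (a j)) := by
    have h : Tendsto (fun m : ℕ => w j ^ ((m : ℝ)⁻¹)) atTop (𝓝 (w j ^ (0 : ℝ))) :=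
      (Real.continuousAt_const_rpow hj).tendsto.comp tendsto_inv_atTop_nhds_zero_nat
    simpa using h.mul_const (a j)
  refine tendsto_of_tendsto_of_tendsto_of_le_of_le' hroot tendsto_const_nhds ?_ ?_
  · filter_upwards [eventually_ne_atTop 0] with m hm
    calc w j ^ ((m : ℝ)⁻¹) * a j = (w j * a j ^ m) ^ ((m : ℝ)⁻¹) := by
          rw [Real.mul_rpow (hw j) (pow_nonneg (ha j) m), Real.pow_rpow_inv_natCast (ha j) hm]
      _ ≤ (∑ i, w i * a i ^ m) ^ ((m : ℝ)⁻¹) := by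
          refine Real.rpow_le_rpow (mul_nonneg (hw j) (pow_nonneg (ha j) m)) ?_ (by positivity)
          exact Finset.single_le_sum (f := fun i => w i * a i ^ m)
            (fun i _ => mul_nonneg (hw i) (pow_nonneg (ha i) m)) (Finset.mem_univ j)
  · filter_upwards [eventually_ne_atTop 0] with m hm
    calc (∑ i, w i * a i ^ m) ^ ((m : ℝ)⁻¹) ≤ (a j ^ m) ^ ((m : ℝ)⁻¹) := by
          refine Real.rpow_le_rpow
            (Finset.sum_nonneg fun i _ => mul_nonneg (hw i) (pow_nonneg (ha i) m)) ?_
            (by positivity)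
          rw [← one_mul (a j ^ m), ← hw1, Finset.sum_mul]
          refine Finset.sum_le_sum fun i _ => ?_
          by_cases hi : w i = 0
          · simp [hi]
          · exact mul_le_mul_of_nonneg_left (pow_le_pow_left₀ (ha i) (hmax i hi) m) (hw i)
      _ = a j := Real.pow_rpow_inv_natCast (ha j) hm

/-- Expansion of a vector in an orthonormal family of full size. -/
theorem sum_dotProduct_smul_eq_of_orthonormal {n : ℕ} (u : Fin n → Fin n → ℝ)
    (horth : ∀ i j, u i ⬝ᵥ u j = if i = j then (1 : ℝ) else 0) (f : Fin n → ℝ) :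
    ∑ i, (u i ⬝ᵥ f) • u i = f := by
  have h : Matrix.of u * (Matrix.of u)ᵀ = 1 := by
    ext i j
    simpa [Matrix.mul_apply, Matrix.one_apply, dotProduct] using horth i j
  have hf : (Matrix.of u)ᵀ *ᵥ (Matrix.of u *ᵥ f) = f := by
    rw [Matrix.mulVec_mulVec, mul_eq_one_comm.mp h, Matrix.one_mulVec]
  rw [Matrix.mulVec_transpose, Matrix.vecMul_eq_sum] at hf
  exact hf

theorem pow_mulVec_of_mulVec_eq_smul {n : ℕ} {L : Matrix (Fin n) (Fin n) ℝ} {v : Fin n → ℝ}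
    {c : ℝ} (h : L *ᵥ v = c • v) (m : ℕ) : (L ^ m) *ᵥ v = c ^ m • v := by
  induction m with
  | zero => simp
  | succ m ih =>
    rw [pow_succ, ← Matrix.mulVec_mulVec, h, Matrix.mulVec_smul, ih, smul_smul, pow_succ, mul_comm]

/-- The quadratic form of `L ^ m` in an orthonormal eigenbasis of `L`. -/
theorem dotProduct_pow_mulVec_eq_sum {n : ℕ} {L : Matrix (Fin n) (Fin n) ℝ} {lam : Fin n → ℝ}
    {u : Fin n → Fin n → ℝ} (horth : ∀ i j, u i ⬝ᵥ u j = if i = j then (1 : ℝ) else 0)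
    (heig : ∀ i, L *ᵥ u i = lam i • u i) (f : Fin n → ℝ) (m : ℕ) :
    f ⬝ᵥ ((L ^ m) *ᵥ f) = ∑ i, (u i ⬝ᵥ f) ^ 2 * lam i ^ m := by
  have h : (L ^ m) *ᵥ f = ∑ i, ((u i ⬝ᵥ f) * lam i ^ m) • u i := by
    conv_lhs => rw [← sum_dotProduct_smul_eq_of_orthonormal u horth f]
    rw [Matrix.mulVec_sum]
    refine Finset.sum_congr rfl fun i _ => ?_
    rw [Matrix.mulVec_smul, pow_mulVec_of_mulVec_eq_smul (heig i), smul_smul]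
  rw [h, dotProduct_sum]
  refine Finset.sum_congr rfl fun i _ => ?_
  rw [dotProduct_smul, dotProduct_comm f, smul_eq_mul]
  ring

theorem bandwidth_estimate_tendsto_bandwidth
    (n : ℕ) (L : Matrix (Fin n) (Fin n) ℝ) (hL : L.IsSymm)
    -- orthonormal eigenvectors `u i` with nonnegative eigenvalues `λ i`:
    (lam : Fin n → ℝ) (hlam : ∀ i, 0 ≤ lam i)
    (u : Fin n → Fin n → ℝ)
    (horth : ∀ i j, u i ⬝ᵥ u j = if i = j then (1 : ℝ) else 0)
    (heig : ∀ i, L *ᵥ u i = lam i • u i)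
    -- a nonzero signal `f`:
    (f : Fin n → ℝ) (hf : f ≠ 0) :
    Tendsto (fun m : ℕ => ((f ⬝ᵥ ((L ^ m) *ᵥ f)) / (f ⬝ᵥ f)) ^ ((m : ℝ)⁻¹))
      atTop (𝓝 (signalBandwidth lam u f)) := by
  have hff : f ⬝ᵥ f ≠ 0 := fun h => hf (dotProduct_self_eq_zero.mp h)
  have hsum : f ⬝ᵥ f = ∑ i, (u i ⬝ᵥ f) ^ 2 := by
    simpa using dotProduct_pow_mulVec_eq_sum horth heig f 0
  have hpos : 0 ≤ f ⬝ᵥ f := hsum ▸ Finset.sum_nonneg fun i _ => sq_nonneg _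
  have hne : {i | u i ⬝ᵥ f ≠ 0}.Nonempty := by
    by_contra! h
    refine hff (hsum.trans (Finset.sum_eq_zero fun i _ => ?_))
    have hi : i ∉ {i | u i ⬝ᵥ f ≠ 0} := h ▸ Set.notMem_empty i
    simpa using hi
  obtain ⟨j, hj, hmax⟩ := Set.exists_max_image _ lam (Set.toFinite _) hne
  have hband : signalBandwidth lam u f = lam j :=
    IsGreatest.csSup_eq ⟨Set.mem_image_of_mem lam hj, Set.forall_mem_image.mpr hmax⟩
  rw [hband]
  have hlim := tendsto_weighted_powerMean_atTop (fun i => (u i ⬝ᵥ f) ^ 2 / (f ⬝ᵥ f)) lam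
    (fun i => div_nonneg (sq_nonneg _) hpos)
    (by rw [← Finset.sum_div, ← hsum, div_self hff]) hlam j
    (div_ne_zero (pow_ne_zero 2 hj) hff)
    (fun i hi => hmax i fun h => hi (by simp [h]))
  refine hlim.congr fun m => ?_
  rw [dotProduct_pow_mulVec_eq_sum horth heig, Finset.sum_div]
  simp only [div_mul_eq_mul_div]
end
end
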